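/- arXiv:2005.01635 — 5 statements merged into one kernel-verified Lean document; each statement's English description precedes it below -/
import Mathlib

section
/- For every integer n ≥ 7, the graph Ψ_n = Cay(D_n, {τ_0, τ_1, τ_3}) has girth exactly 6. -/
/-- The Cayley graph of a group on a (symmetric) connection set `S`:
distinct `g, h` are adjacent iff `g * h⁻¹ ∈ S`. -/
def cayley {G : Type*} [Group G] (S : Set G) : SimpleGraph G :=
  SimpleGraph.fromRel (fun x y => x * y⁻¹ ∈ S)

/-- In the dihedral group `D_n = ⟨ρ, τ⟩`, the element `τ_i = ρ^i * τ`. -/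
def dihTau {n : ℕ} (i : ℕ) : DihedralGroup n :=
  (DihedralGroup.r 1) ^ i * DihedralGroup.sr 0

/-- The graph `Ψ_n = Cay(D_n, {τ_0, τ_1, τ_3})`. -/
def psiGraph (n : ℕ) : SimpleGraph (DihedralGroup n) :=
  cayley ({dihTau 0, dihTau 1, dihTau 3} : Set (DihedralGroup n))

open DihedralGroup

lemma dihTau_eq_sr {n : ℕ} (i : ℕ) : (dihTau i : DihedralGroup n) = sr (-(i : ZMod n)) := by
  simp [dihTau]

lemma psiGraph_adj_r_sr {n : ℕ} (i j : ZMod n) :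
    (psiGraph n).Adj (r i) (sr j) ↔ ∃ x : ℤ, (x = 0 ∨ x = 1 ∨ x = 3) ∧ i - j = x := by
  have h (a : ZMod n) : j - i = -a ↔ i - j = a := by rw [← neg_sub, neg_inj]
  have h0 : j - i = 0 ↔ i - j = 0 := by simpa using h 0
  simp [psiGraph, cayley, dihTau_eq_sr, ← sub_eq_add_neg, h, h0, or_and_right, exists_or]

lemma psiGraph_not_adj_r_r {n : ℕ} (i j : ZMod n) : ¬ (psiGraph n).Adj (r i) (r j) := by
  simp [psiGraph, cayley, dihTau_eq_sr]

lemma psiGraph_not_adj_sr_sr {n : ℕ} (i j : ZMod n) : ¬ (psiGraph n).Adj (sr i) (sr j) := by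
  simp [psiGraph, cayley, dihTau_eq_sr]

/-- The bipartition of `Ψ_n` into rotations and reflections. -/
def psiColoring (n : ℕ) : (psiGraph n).Coloring Bool :=
  SimpleGraph.Coloring.mk (fun g => match g with | r _ => true | sr _ => false) (by
    rintro (i | i) (j | j) h
    · exact absurd h (psiGraph_not_adj_r_r i j)
    · simp
    · simp
    · exact absurd h (psiGraph_not_adj_sr_sr i j))

lemma ZMod.intCast_eq_zero_of_abs_lt {n : ℕ} {x : ℤ} (hx : |x| < n) (h : (x : ZMod n) = 0) :
    x = 0 :=
  Int.eq_zero_of_abs_lt_dvd ((ZMod.intCast_zmod_eq_zero_iff_dvd x n).1 h) hx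

/-- Two rotations with two common neighbours in `Ψ_n` coincide. -/
lemma psiGraph_square_r_sr {n : ℕ} (hn : 7 ≤ n) {i j k l : ZMod n}
    (hij : (psiGraph n).Adj (r i) (sr j)) (hkj : (psiGraph n).Adj (r k) (sr j))
    (hkl : (psiGraph n).Adj (r k) (sr l)) (hil : (psiGraph n).Adj (r i) (sr l)) :
    i = k ∨ j = l := by
  rw [psiGraph_adj_r_sr] at hij hkj hkl hil
  obtain ⟨x, hx, ex⟩ := hij
  obtain ⟨y, hy, ey⟩ := hkj
  obtain ⟨z, hz, ez⟩ := hkl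
  obtain ⟨w, hw, ew⟩ := hil
  have h : x - y + z - w = 0 := by
    refine ZMod.intCast_eq_zero_of_abs_lt (n := n) (by rw [abs_lt]; omega) ?_
    push_cast
    rw [← ex, ← ey, ← ez, ← ew]
    ring
  have hxy : x = y ∨ x = w := by omega
  rcases hxy with rfl | rfl
  · exact .inl (sub_left_injective (ex.trans ey.symm))
  · exact .inr (sub_right_injective (ex.trans ew.symm))

lemma psiGraph_square {n : ℕ} (hn : 7 ≤ n) {a b c d : DihedralGroup n}
    (hab : (psiGraph n).Adj a b) (hbc : (psiGraph n).Adj b c)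
    (hcd : (psiGraph n).Adj c d) (hda : (psiGraph n).Adj d a) : a = c ∨ b = d := by
  rcases a with i | i <;> rcases b with j | j <;> rcases c with k | k <;> rcases d with l | l <;>
    try simp only [psiGraph_not_adj_r_r, psiGraph_not_adj_sr_sr] at hab hbc hcd hda
  · simpa using psiGraph_square_r_sr hn hab hbc.symm hcd hda.symm
  · simpa [eq_comm, or_comm] using psiGraph_square_r_sr hn hab.symm hda hcd.symm hbc

lemma psiGraph_six_le_length {n : ℕ} (hn : 7 ≤ n) {a : DihedralGroup n}
    (w : (psiGraph n).Walk a a) (hw : w.IsCycle) : 6 ≤ w.length := by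
  have h3 := hw.three_le_length
  obtain ⟨m, hm⟩ := ((psiColoring n).even_length_iff_congr w).2 Iff.rfl
  by_contra! hlt
  have h4 : w.length = 4 := by omega
  have hnd := hw.support_nodup
  match w, h4 with
  | .cons hab (.cons hbc (.cons hcd (.cons hda .nil))), _ =>
    rcases psiGraph_square hn hab hbc hcd hda with rfl | rfl <;> simp at hnd

lemma psiGraph_exists_hexagon {n : ℕ} (hn : 7 ≤ n) :
    ∃ (a : DihedralGroup n) (w : (psiGraph n).Walk a a), w.IsCycle ∧ w.length = 6 := by
  have hne (x : ℤ) (hx : |x| < 7) (h0 : x ≠ 0) : (x : ZMod n) ≠ 0 := fun h =>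
    h0 (ZMod.intCast_eq_zero_of_abs_lt (hx.trans_le (by exact_mod_cast hn)) h)
  have h1 : (1 : ZMod n) ≠ 0 := by simpa using hne 1 (by norm_num) (by norm_num)
  have h2 : (2 : ZMod n) ≠ 0 := by simpa using hne 2 (by norm_num) (by norm_num)
  have h3 : (3 : ZMod n) ≠ 0 := by simpa using hne 3 (by norm_num) (by norm_num)
  have adj {i j : ZMod n} (x : ℤ) (hx : x = 0 ∨ x = 1 ∨ x = 3) (e : i - j = x) :
      (psiGraph n).Adj (r i) (sr j) := (psiGraph_adj_r_sr i j).2 ⟨x, hx, e⟩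
  have e1 : (psiGraph n).Adj (r 0) (sr 0) := adj 0 (by simp) (by simp)
  have e2 : (psiGraph n).Adj (r 1) (sr 0) := adj 1 (by simp) (by simp)
  have e3 : (psiGraph n).Adj (r 1) (sr (-2)) := adj 3 (by simp) (by push_cast; ring)
  have e4 : (psiGraph n).Adj (r (-2)) (sr (-2)) := adj 0 (by simp) (by simp)
  have e5 : (psiGraph n).Adj (r (-2)) (sr (-3)) := adj 1 (by simp) (by push_cast; ring)
  have e6 : (psiGraph n).Adj (r 0) (sr (-3)) := adj 3 (by simp) (by simp)
  have h12 : (1 : ZMod n) ≠ -2 := fun h => h3 (by linear_combination h)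
  have h23 : (2 : ZMod n) ≠ 3 := fun h => h1 (by linear_combination -h)
  refine ⟨r 0, .cons e1 (.cons e2.symm (.cons e3 (.cons e4.symm (.cons e5 (.cons e6.symm .nil))))),
    ?_, rfl⟩
  rw [SimpleGraph.Walk.isCycle_def, SimpleGraph.Walk.isTrail_def]
  simp [-r_zero, h1, h2, h3, h12, h23, h1.symm]

theorem psi_girth_eq_six (n : ℕ) (hn : 7 ≤ n) : (psiGraph n).girth = 6 := by
  obtain ⟨a, w, hw, hlen⟩ := psiGraph_exists_hexagon hn
  refine le_antisymm (hlen ▸ SimpleGraph.girth_le_length hw) ?_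
  obtain ⟨b, v, hv, hg⟩ := SimpleGraph.exists_girth_eq_length.2 fun h => h w hw
  exact hg ▸ psiGraph_six_le_length hn v hv
end

section
/- For every integer n ≥ 3, the full automorphism group of the graph Δ_n = Cay(D_{3n}, {τ_0, τ_k, τ_n}), where k = 3/gcd(3, n), is isomorphic to the dihedral group D_{3n} of order 6n; that is, Δ_n is a graphical regular representation of D_{3n}. -/
/-- The graph `Δ_n = Cay(D_{3n}, {τ_0, τ_k, τ_n})`, where `k = 3 / gcd(3, n)`. -/
def deltaGraph (n : ℕ) : SimpleGraph (DihedralGroup (3 * n)) :=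
  cayley ({dihTau 0, dihTau (3 / Nat.gcd 3 n), dihTau n} : Set (DihedralGroup (3 * n)))

open DihedralGroup

/-- The incidence relation of the Haar graph of a ring with connection set `{0, -k, -n}`. -/
def HaarInc {R : Type*} [CommRing R] (k n a b : R) : Prop :=
  b = a ∨ b = a - k ∨ b = a - n

/-- Every path of length two starting at `b₁`, whose first edge avoids `a`, can be closed up
to a hexagon through `b₁, a, b₂`. -/
def HexExt {R : Type*} [CommRing R] (k n a b₁ b₂ : R) : Prop :=
  ∀ a₁, HaarInc k n a₁ b₁ → a₁ ≠ a → ∃ a₂ b,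
    HaarInc k n a₂ b₂ ∧ a₂ ≠ a ∧ HaarInc k n a₁ b ∧ HaarInc k n a₂ b

/-- The small linear combinations of `k` and `n` that have to be nonzero for the Haar graph
to contain no unexpected hexagons. -/
structure HexGeneric {R : Type*} [CommRing R] (k n : R) : Prop where
  three_n : 3 * n = 0
  n_ne : n ≠ 0
  k_ne : k ≠ 0
  two_k : 2 * k ≠ 0
  three_k : 3 * k ≠ 0
  k_add : k + n ≠ 0
  k_sub : k - n ≠ 0
  two_k_add : 2 * k + n ≠ 0
  two_k_sub : 2 * k - n ≠ 0
  three_k_add : 3 * k + n ≠ 0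
  three_k_sub : 3 * k - n ≠ 0

section Haar

variable {R : Type*} [CommRing R] {k n : R}

lemma HexExt.map {f g : R → R} (hf : f.Bijective)
    (h : ∀ a b, HaarInc k n (f a) (g b) ↔ HaarInc k n a b) {a b₁ b₂ : R}
    (H : HexExt k n a b₁ b₂) : HexExt k n (f a) (g b₁) (g b₂) := by
  intro a₁' h₁ hne
  obtain ⟨a₁, rfl⟩ := hf.2 a₁'
  obtain ⟨a₂, b, h₂, hne₂, h₃, h₄⟩ := H a₁ ((h _ _).1 h₁) (fun e => hne (by rw [e]))
  exact ⟨f a₂, g b, (h _ _).2 h₂, fun e => hne₂ (hf.1 e), (h _ _).2 h₃, (h _ _).2 h₄⟩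

namespace HexGeneric

lemma hexExt_zero_n (h : HexGeneric k n) (a : R) : HexExt k n a a (a - n) := by
  have h3 := h.three_n
  have hn := h.n_ne
  have hkn := h.k_sub
  rintro a₁ (e | e | e) hne
  · exact absurd e.symm hne
  · refine ⟨a - n + k, a - n + k, Or.inr (Or.inl (by ring)), fun e' => hkn ?_,
      Or.inr (Or.inr ?_), Or.inl rfl⟩
    · linear_combination e'
    · linear_combination e
  · refine ⟨a - n, a + n, Or.inl rfl, fun e' => hn ?_, Or.inl ?_, Or.inr (Or.inr ?_)⟩
    · linear_combination -e'
    · linear_combination e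
    · linear_combination h3

lemma hexExt_n_zero (h : HexGeneric k n) (a : R) : HexExt k n a (a - n) a := by
  have h3 := h.three_n
  have hn := h.n_ne
  have hk := h.k_ne
  rintro a₁ (e | e | e) hne
  · refine ⟨a + n, a + n, Or.inr (Or.inr (by ring)), fun e' => hn ?_,
      Or.inr (Or.inr ?_), Or.inl rfl⟩
    · linear_combination e'
    · linear_combination e + h3
  · refine ⟨a + k, a + k - n, Or.inr (Or.inl (by ring)), fun e' => hk ?_,
      Or.inl ?_, Or.inr (Or.inr rfl)⟩
    · linear_combination e'
    · linear_combination e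
  · exact absurd (by linear_combination -e) hne

lemma not_hexExt_zero_k (h : HexGeneric k n) (a : R) : ¬ HexExt k n a a (a - k) := by
  obtain ⟨h0, h1, h2, h3, h4, h5, h6, h7, h8, h9, h10⟩ := h
  have h11 : k - 2 * n ≠ 0 := fun e => h5 (by linear_combination e + h0)
  have h12 : 2 * k - 2 * n ≠ 0 := fun e => h7 (by linear_combination e + h0)
  have h13 : 3 * k - 2 * n ≠ 0 := fun e => h9 (by linear_combination e + h0)
  intro H
  obtain ⟨a₂, b, e, hne, e₁, e₂⟩ := H (a + k) (Or.inr (Or.inl (by ring)))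
    (fun e => h2 (by linear_combination e))
  unfold HaarInc at e e₁ e₂
  grind

lemma not_hexExt_n_k (h : HexGeneric k n) (a : R) : ¬ HexExt k n a (a - n) (a - k) := by
  obtain ⟨h0, h1, h2, h3, h4, h5, h6, h7, h8, h9, h10⟩ := h
  have h11 : k - 2 * n ≠ 0 := fun e => h5 (by linear_combination e + h0)
  have h12 : 2 * k - 2 * n ≠ 0 := fun e => h7 (by linear_combination e + h0)
  have h13 : 3 * k - 2 * n ≠ 0 := fun e => h9 (by linear_combination e + h0)
  intro H
  obtain ⟨a₂, b, e, hne, e₁, e₂⟩ := H (a - n + k) (Or.inr (Or.inl (by ring)))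
    (fun e => h6 (by linear_combination e))
  unfold HaarInc at e e₁ e₂
  grind

/-- Automorphisms of a generic Haar graph preserve the perfect matching of type `k`. -/
lemma map_sub_k (h : HexGeneric k n) {f g : R → R} (hf : f.Bijective) (hg : g.Bijective)
    (hI : ∀ a b, HaarInc k n (f a) (g b) ↔ HaarInc k n a b) (a : R) :
    g (a - k) = f a - k := by
  have A := (h.hexExt_zero_n a).map hf hI
  have B := (h.hexExt_n_zero a).map hf hI
  have C := h.not_hexExt_zero_k (f a)
  have D := h.not_hexExt_n_k (f a)
  have i₀ : HaarInc k n (f a) (g a) := (hI _ _).2 (Or.inl rfl)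
  have i₁ : HaarInc k n (f a) (g (a - k)) := (hI _ _).2 (Or.inr (Or.inl rfl))
  have i₂ : HaarInc k n (f a) (g (a - n)) := (hI _ _).2 (Or.inr (Or.inr rfl))
  have hn := h.n_ne
  have hk := h.k_ne
  have hkn := h.k_sub
  have n₀₂ : g a ≠ g (a - n) := fun e => hn (by linear_combination hg.1 e)
  have n₀₁ : g a ≠ g (a - k) := fun e => hk (by linear_combination hg.1 e)
  have n₁₂ : g (a - k) ≠ g (a - n) := fun e => hkn (by linear_combination -hg.1 e)
  unfold HaarInc at i₀ i₁ i₂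
  grind

lemma map_inc (h : HexGeneric k n) {f g : R → R} (hf : f.Bijective) (hg : g.Bijective)
    (hI : ∀ a b, HaarInc k n (f a) (g b) ↔ HaarInc k n a b) {a c : R}
    (hc : c = a + k ∨ c = a + k - n) : f c = f a + k ∨ f c = f a + k - n := by
  have hk := h.map_sub_k hf hg hI c
  have hne : c ≠ a := by
    rintro rfl
    rcases hc with e | e
    · exact h.k_ne (by linear_combination -e)
    · exact h.k_sub (by linear_combination -e)
  have hI' : HaarInc k n (f a) (g (c - k)) := (hI _ _).2 <| by
    rcases hc with rfl | rfl
    · exact Or.inl (by ring)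
    · exact Or.inr (Or.inr (by ring))
  have hfne : f c ≠ f a := fun e => hne (hf.1 e)
  rw [hk] at hI'
  rcases hI' with e | e | e
  · exact Or.inl (by linear_combination e)
  · exact absurd (by linear_combination e) hfne
  · exact Or.inr (by linear_combination e)

/-- An automorphism of a generic Haar graph shifts every fibre `a + ⟨n⟩` either forwards or
backwards, and this determines the image of the next fibre. -/
lemma map_sub_n_or (h : HexGeneric k n) {f g : R → R} (hf : f.Bijective) (hg : g.Bijective)
    (hI : ∀ a b, HaarInc k n (f a) (g b) ↔ HaarInc k n a b) (a : R) :
    (f (a - n) = f a - n ∧ f (a + k) = f a + k ∧ f (a + k - n) = f a + k - n) ∨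
      (f (a - n) = f a + n ∧ f (a + k) = f a + k - n ∧ f (a + k - n) = f a + k) := by
  have h0 := h.n_ne
  have h3 := h.three_n
  have hn : f (a - n) ≠ f a := fun e => h0 (by linear_combination -hf.1 e)
  have hkn : f (a + k) ≠ f (a + k - n) := fun e => h0 (by linear_combination hf.1 e)
  have i₁ := h.map_inc hf hg hI (a := a) (Or.inl rfl)
  have i₂ := h.map_inc hf hg hI (a := a) (Or.inr rfl)
  have i₃ := h.map_inc hf hg hI (a := a - n) (c := a + k - n) (Or.inl (by ring))
  grind

lemma map_sub_n_iff (h : HexGeneric k n) {f g : R → R} (hf : f.Bijective) (hg : g.Bijective)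
    (hI : ∀ a b, HaarInc k n (f a) (g b) ↔ HaarInc k n a b) (a : R) :
    (f (a + k - n) = f (a + k) - n ↔ f (a - n) = f a - n) ∧
      (f (a - n - n) = f (a - n) - n ↔ f (a - n) = f a - n) := by
  have h0 := h.n_ne
  have h3 := h.three_n
  have hn : f (a - n - n) ≠ f a := fun e => h0 (by linear_combination hf.1 e + h3)
  have h2 : 2 * n ≠ 0 := fun e => h0 (by linear_combination h3 - e)
  have i₁ := h.map_sub_n_or hf hg hI a
  have i₂ := h.map_sub_n_or hf hg hI (a - n)
  grind

end HexGeneric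

end Haar

/-- If `k` and `n` generate `ZMod m` with `m = 3 * n`, then a property of `0` that is stable
under translation by `k` and `-n` holds everywhere. -/
lemma zmod_induction {n : ℕ} (hn : 3 ≤ n) {P : ZMod (3 * n) → Prop} (h0 : P 0)
    (hk : ∀ a, P a → P (a + (3 / Nat.gcd 3 n : ℕ))) (hs : ∀ a, P a → P (a - n)) (a : ZMod (3 * n)) :
    P a := by
  have : NeZero (3 * n) := ⟨by omega⟩
  have key : ∀ i j : ℕ, P (i * (3 / Nat.gcd 3 n : ℕ) - j * n) := by
    intro i j
    induction j with
    | zero =>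
      induction i with
      | zero => simpa using h0
      | succ i ih => convert hk _ ih using 1; push_cast; ring
    | succ j ih => convert hs _ ih using 1; push_cast; ring
  by_cases hd : 3 ∣ n
  · rw [Nat.gcd_eq_left hd] at key
    simpa using key a.val 0
  · have hg : Nat.gcd 3 n = 1 := (Nat.Prime.coprime_iff_not_dvd Nat.prime_three).2 hd
    rw [hg] at key
    have hx : ∃ i j : ℕ, 3 * i = a.val + j * n := by
      have : n % 3 = 1 ∨ n % 3 = 2 := by omega
      rcases this with h | h
      · refine ⟨(a.val + (2 * a.val) * n) / 3, 2 * a.val, Nat.mul_div_cancel' ?_⟩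
        obtain ⟨q, hq⟩ : ∃ q, n = 3 * q + 1 := ⟨n / 3, by omega⟩
        exact ⟨a.val + 2 * a.val * q, by linear_combination 2 * a.val * hq⟩
      · refine ⟨(a.val + a.val * n) / 3, a.val, Nat.mul_div_cancel' ?_⟩
        obtain ⟨q, hq⟩ : ∃ q, n = 3 * q + 2 := ⟨n / 3, by omega⟩
        exact ⟨a.val + a.val * q, by linear_combination a.val * hq⟩
    obtain ⟨i, j, hij⟩ := hx
    convert key i j using 1
    have := congrArg (Nat.cast : ℕ → ZMod (3 * n)) hij
    push_cast [ZMod.natCast_zmod_val] at this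
    push_cast
    linear_combination -this

lemma hexGeneric_delta {n : ℕ} (hn : 4 ≤ n) :
    HexGeneric ((3 / Nat.gcd 3 n : ℕ) : ZMod (3 * n)) (n : ZMod (3 * n)) := by
  obtain ⟨κ, hκ, hκn⟩ : ∃ κ : ℕ, 3 / Nat.gcd 3 n = κ ∧ (κ = 1 ∨ κ = 3 ∧ n % 3 ≠ 0) := by
    by_cases hd : 3 ∣ n
    · exact ⟨1, by rw [Nat.gcd_eq_left hd], Or.inl rfl⟩
    · have hg : Nat.gcd 3 n = 1 := (Nat.Prime.coprime_iff_not_dvd Nat.prime_three).2 hd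
      exact ⟨3, by rw [hg], Or.inr ⟨rfl, by omega⟩⟩
  rw [hκ]
  have lin : ∀ i j : ℤ, 0 ≤ i → i ≤ 3 → -1 ≤ j → j ≤ 1 →
      i * κ + j * n ≠ 0 → i * κ + j * n ≠ 3 * n →
      (i : ZMod (3 * n)) * (κ : ZMod (3 * n)) + j * n ≠ 0 := by
    intro i j hi hi' hj hj' h0 h1 h
    have h' : ((i * κ + j * n : ℤ) : ZMod (3 * n)) = 0 := by push_cast; exact h
    rw [ZMod.intCast_zmod_eq_zero_iff_dvd] at h'
    obtain ⟨q, hq⟩ := h'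
    push_cast at hq
    have hκ0 : (0 : ℤ) ≤ κ ∧ (κ : ℤ) ≤ 3 := by omega
    have hn' : (4 : ℤ) ≤ n := by exact_mod_cast hn
    have b1 : 0 ≤ i * κ := mul_nonneg hi hκ0.1
    have b2 : i * κ ≤ 9 := by nlinarith
    have b3 : -n ≤ j * n := by nlinarith
    have b4 : j * n ≤ n := by nlinarith
    have q1 : -1 < q := by
      by_contra hc
      nlinarith
    have q2 : q < 2 := by
      by_contra hc
      nlinarith
    interval_cases q
    · exact h0 (by linarith)
    · exact h1 (by linarith)
  have lin' : ∀ i j : ℤ, 0 ≤ i → i ≤ 3 → -1 ≤ j → j ≤ 1 →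
      i * κ + j * n ≠ 0 → i * κ + j * n ≠ 3 * n → ∀ x : ZMod (3 * n),
      x = i * κ + j * n → x ≠ 0 := by
    rintro i j h1 h2 h3 h4 h5 h6 x rfl
    exact lin i j h1 h2 h3 h4 h5 h6
  constructor
  · exact_mod_cast ZMod.natCast_self (3 * n)
  · apply lin' 0 1 <;> first | omega | (push_cast; ring)
  · apply lin' 1 0 <;> first | omega | (push_cast; ring)
  · apply lin' 2 0 <;> first | omega | (push_cast; ring)
  · apply lin' 3 0 <;> first | omega | (push_cast; ring)
  · apply lin' 1 1 <;> first | omega | (push_cast; ring)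
  · apply lin' 1 (-1) <;> first | omega | (push_cast; ring)
  · apply lin' 2 1 <;> first | omega | (push_cast; ring)
  · apply lin' 2 (-1) <;> first | omega | (push_cast; ring)
  · apply lin' 3 1 <;> first | omega | (push_cast; ring)
  · apply lin' 3 (-1) <;> first | omega | (push_cast; ring)

instance {R : Type*} [CommRing R] [DecidableEq R] (k n a b : R) : Decidable (HaarInc k n a b) :=
  inferInstanceAs (Decidable (_ ∨ _ ∨ _))

/-- All walks of length three from `a` to `b` have the same second vertex. -/
def UniqueSecondVertex {R : Type*} [CommRing R] (k n a b : R) : Prop :=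
  ∀ b₁, HaarInc k n a b₁ → ∀ a₁, HaarInc k n a₁ b₁ → HaarInc k n a₁ b →
    ∀ b₂, HaarInc k n a b₂ → ∀ a₂, HaarInc k n a₂ b₂ → HaarInc k n a₂ b → b₁ = b₂

instance {R : Type*} [CommRing R] [DecidableEq R] [Fintype R] (k n a b : R) :
    Decidable (UniqueSecondVertex k n a b) := by
  unfold UniqueSecondVertex; infer_instance

lemma UniqueSecondVertex.map {R : Type*} [CommRing R] {k n : R} {f g : R → R} (hf : f.Bijective)
    (hg : g.Bijective) (h : ∀ a b, HaarInc k n (f a) (g b) ↔ HaarInc k n a b) {a b : R}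
    (H : UniqueSecondVertex k n a b) : UniqueSecondVertex k n (f a) (g b) := by
  intro b₁ h₁ a₁ h₂ h₃ b₂ h₄ a₂ h₅ h₆
  obtain ⟨b₁, rfl⟩ := hg.2 b₁
  obtain ⟨b₂, rfl⟩ := hg.2 b₂
  obtain ⟨a₁, rfl⟩ := hf.2 a₁
  obtain ⟨a₂, rfl⟩ := hf.2 a₂
  rw [h] at h₁ h₂ h₃ h₄ h₅ h₆
  rw [H b₁ h₁ a₁ h₂ h₃ b₂ h₄ a₂ h₅ h₆]

set_option maxRecDepth 100000 in
lemma uniqueSecondVertex_nine : ∀ a b : ZMod 9, UniqueSecondVertex 1 3 a b ↔ b = a + 4 := by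
  decide

lemma haar_rigid_three {f g : ZMod 9 → ZMod 9} (hf : f.Bijective) (hg : g.Bijective)
    (hI : ∀ a b, HaarInc 1 3 (f a) (g b) ↔ HaarInc 1 3 a b) (h0 : f 0 = 0) :
    (∀ a, f a = a) ∧ ∀ b, g b = b := by
  have hg4 : ∀ a, g (a + 4) = f a + 4 := fun a =>
    (uniqueSecondVertex_nine _ _).1 (((uniqueSecondVertex_nine a (a + 4)).2 rfl).map hf hg hI)
  have arc : ∀ a c : ZMod 9,
      (HaarInc 1 3 a (c + 4) ∧ ¬ HaarInc 1 3 c (a + 4)) ↔ c = a + 2 := by decide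
  have step : ∀ a, f (a + 2) = f a + 2 := by
    intro a
    rw [← arc, ← hg4, ← hg4, hI, hI, arc]
  have hfix : ∀ a, f a = a := by
    have key : ∀ i : ℕ, f (i * 2) = i * 2 := by
      intro i
      induction i with
      | zero => simpa using h0
      | succ i ih =>
        have := step (i * 2)
        rw [ih] at this
        convert this using 2 <;> push_cast <;> ring
    intro a
    have h2 : ∀ a : ZMod 9, ((5 * a.val : ℕ) : ZMod 9) * 2 = a := by decide
    have := key (5 * a.val)
    rwa [h2] at this
  refine ⟨hfix, fun b => ?_⟩
  have := hg4 (b - 4)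
  rwa [hfix, sub_add_cancel] at this

lemma haar_rigid {n : ℕ} (hn : 4 ≤ n) {f g : ZMod (3 * n) → ZMod (3 * n)} (hf : f.Bijective)
    (hg : g.Bijective)
    (hI : ∀ a b, HaarInc ((3 / Nat.gcd 3 n : ℕ) : ZMod (3 * n)) n (f a) (g b) ↔
      HaarInc ((3 / Nat.gcd 3 n : ℕ) : ZMod (3 * n)) n a b) (h0 : f 0 = 0) :
    (∀ a, f a = a) ∧ ∀ b, g b = b := by
  have h := hexGeneric_delta hn
  have hk3 : ¬ 3 ∣ 2 * (3 / Nat.gcd 3 n) + 2 * n := by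
    by_cases hd : 3 ∣ n
    · rw [Nat.gcd_eq_left hd]
      omega
    · rw [(Nat.Prime.coprime_iff_not_dvd Nat.prime_three).2 hd]
      omega
  set κ : ℕ := 3 / Nat.gcd 3 n with hκ
  have h3 := h.three_n
  have stepn := h.map_sub_n_or hf hg hI
  have stepi := h.map_sub_n_iff hf hg hI
  have const : ∀ a, (f (a - n) = f a - n ↔ f (0 - n) = f 0 - n) :=
    zmod_induction (by omega) Iff.rfl (fun a ha => (stepi a).1.trans ha)
      (fun a ha => (stepi a).2.trans ha)
  have hfix : ∀ a, f a = a := by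
    by_cases hc : f (0 - n) = f 0 - n
    · have hc' : ∀ a, f (a - n) = f a - n := fun a => (const a).2 hc
      have hck : ∀ a, f (a + κ) = f a + κ := by
        intro a
        have := h.n_ne
        have := hc' a
        grind
      exact zmod_induction (by omega) h0 (fun a ha => by rw [hck, ha])
        (fun a ha => by rw [hc', ha])
    · exfalso
      have hc' : ∀ a, f (a - n) = f a + n := fun a =>
        ((stepn a).resolve_left fun e => hc ((const a).1 e.1)).1
      have hck : ∀ a, f (a + κ) = f a + (κ - n) := fun a => by
        rw [((stepn a).resolve_left fun e => hc ((const a).1 e.1)).2.1, add_sub_assoc]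
      have e1 : ∀ i : ℕ, f (i * κ) = i * (κ - n) := by
        intro i
        induction i with
        | zero => simpa using h0
        | succ i ih =>
          push_cast
          rw [add_mul, one_mul, hck, ih]
          ring
      have e2 : ∀ i j : ℕ, f (i * κ - j * n) = i * (κ - n) + j * n := by
        intro i j
        induction j with
        | zero => simpa using e1 i
        | succ j ih =>
          have : (i * κ - (j + 1 : ℕ) * n : ZMod (3 * n)) = i * κ - j * n - n := by
            push_cast; ring
          rw [this, hc', ih]
          push_cast
          ring
      have e3 := e2 n κ
      rw [show (n * κ - κ * n : ZMod (3 * n)) = 0 by ring, h0] at e3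
      have e4 : ((n * (2 * κ + 2 * n) : ℕ) : ZMod (3 * n)) = 0 := by
        push_cast
        linear_combination -e3 + n * h3
      rw [ZMod.natCast_eq_zero_iff, mul_comm 3 n] at e4
      exact hk3 (Nat.dvd_of_mul_dvd_mul_left (by omega) e4)
  refine ⟨hfix, fun b => ?_⟩
  have := h.map_sub_k hf hg hI (b + κ)
  rwa [hfix, add_sub_cancel_right] at this

section Graph

lemma dihTau_eq {m : ℕ} (i : ℕ) : (dihTau i : DihedralGroup m) = sr (-i : ZMod m) := by
  simp [dihTau]

variable {n : ℕ}

lemma deltaGraph_adj_r_sr (a b : ZMod (3 * n)) :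
    (deltaGraph n).Adj (r a) (sr b) ↔ HaarInc ((3 / Nat.gcd 3 n : ℕ) : ZMod (3 * n)) n a b := by
  simp only [deltaGraph, cayley, SimpleGraph.fromRel_adj, dihTau_eq, HaarInc]
  simp
  grind

lemma deltaGraph_not_adj_r_r (a b : ZMod (3 * n)) : ¬ (deltaGraph n).Adj (r a) (r b) := by
  simp [deltaGraph, cayley, SimpleGraph.fromRel_adj, dihTau_eq]

lemma deltaGraph_not_adj_sr_sr (a b : ZMod (3 * n)) : ¬ (deltaGraph n).Adj (sr a) (sr b) := by
  simp [deltaGraph, cayley, SimpleGraph.fromRel_adj, dihTau_eq]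

lemma exists_sr_of_adj_r {a : ZMod (3 * n)} {x : DihedralGroup (3 * n)}
    (h : (deltaGraph n).Adj (r a) x) : ∃ b, x = sr b := by
  cases x with
  | r b => exact absurd h (deltaGraph_not_adj_r_r a b)
  | sr b => exact ⟨b, rfl⟩

lemma exists_r_of_adj_sr {a : ZMod (3 * n)} {x : DihedralGroup (3 * n)}
    (h : (deltaGraph n).Adj (sr a) x) : ∃ b, x = r b := by
  cases x with
  | r b => exact ⟨b, rfl⟩
  | sr b => exact absurd h (deltaGraph_not_adj_sr_sr a b)

lemma deltaGraph_iso_eq_id (hn : 3 ≤ n) (φ : deltaGraph n ≃g deltaGraph n) (h1 : φ 1 = 1)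
    (x : DihedralGroup (3 * n)) : φ x = x := by
  have : NeZero (3 * n) := ⟨by omega⟩
  have hr : ∀ a : ZMod (3 * n), ∃ c, φ (r a) = r c := by
    have two_step : ∀ a c b : ZMod (3 * n), (deltaGraph n).Adj (r a) (sr b) →
        (deltaGraph n).Adj (r c) (sr b) → (∃ d, φ (r a) = r d) → ∃ d, φ (r c) = r d := by
      rintro a c b hab hcb ⟨d, hd⟩
      have h' := φ.map_adj_iff.2 hab
      rw [hd] at h'
      obtain ⟨e, he⟩ := exists_sr_of_adj_r h'
      have h'' := φ.map_adj_iff.2 hcb.symm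
      rw [he] at h''
      exact exists_r_of_adj_sr h''
    refine zmod_induction hn ⟨0, h1⟩ (fun a ha => two_step a _ a ?_ ?_ ha)
      (fun a ha => two_step a _ (a - n) ?_ ?_ ha)
    all_goals rw [deltaGraph_adj_r_sr]
    · exact Or.inl rfl
    · exact Or.inr (Or.inl (by ring))
    · exact Or.inr (Or.inr rfl)
    · exact Or.inl rfl
  have hs : ∀ b : ZMod (3 * n), ∃ c, φ (sr b) = sr c := by
    intro b
    obtain ⟨c, hc⟩ := hr b
    have h' := φ.map_adj_iff.2 ((deltaGraph_adj_r_sr b b).2 (Or.inl rfl))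
    rw [hc] at h'
    exact exists_sr_of_adj_r h'
  choose f hf using hr
  choose g hg using hs
  have hfb : f.Bijective := Finite.injective_iff_bijective.1 fun a b hab => by
    have := φ.injective ((hf a).trans ((congrArg r hab).trans (hf b).symm))
    simpa using this
  have hgb : g.Bijective := Finite.injective_iff_bijective.1 fun a b hab => by
    have := φ.injective ((hg a).trans ((congrArg sr hab).trans (hg b).symm))
    simpa using this
  have hI : ∀ a b, HaarInc ((3 / Nat.gcd 3 n : ℕ) : ZMod (3 * n)) n (f a) (g b) ↔
      HaarInc ((3 / Nat.gcd 3 n : ℕ) : ZMod (3 * n)) n a b := by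
    intro a b
    rw [← deltaGraph_adj_r_sr, ← deltaGraph_adj_r_sr, ← hf, ← hg, φ.map_adj_iff]
  have h0 : f 0 = 0 := by
    have := (hf 0).symm.trans h1
    rw [one_def] at this
    exact r.inj this
  have key : (∀ a, f a = a) ∧ ∀ b, g b = b := by
    rcases hn.eq_or_lt with rfl | hn
    · exact haar_rigid_three hfb hgb (by simpa using hI) h0
    · exact haar_rigid hn hfb hgb hI h0
  cases x with
  | r a => rw [hf, key.1]
  | sr b => rw [hg, key.2]

end Graph

/-- Right translations are automorphisms of a Cayley graph. -/
def cayleyRightMul {G : Type*} [Group G] (S : Set G) : G →* (cayley S ≃g cayley S) where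
  toFun g :=
    { toEquiv := Equiv.mulRight g⁻¹
      map_rel_iff' := by simp [cayley, SimpleGraph.fromRel_adj] }
  map_one' := by ext; simp
  map_mul' g h := by ext; simp [mul_assoc]

/-- For `n ≥ 3`, the full automorphism group of `Δ_n` is isomorphic to the dihedral group
`D_{3n}` of order `6n`, i.e. `Δ_n` is a graphical regular representation of `D_{3n}`. -/
theorem delta_aut_eq_dihedral (n : ℕ) (hn : 3 ≤ n) :
    Nonempty ((deltaGraph n ≃g deltaGraph n) ≃* DihedralGroup (3 * n)) := by
  let Ψ : DihedralGroup (3 * n) →* (deltaGraph n ≃g deltaGraph n) := cayleyRightMul _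
  have hΨ : ∀ g x, Ψ g x = x * g⁻¹ := fun _ _ => rfl
  refine ⟨(MulEquiv.ofBijective Ψ ⟨fun g h hgh => ?_, fun φ => ⟨(φ 1)⁻¹, ?_⟩⟩).symm⟩
  · have := congrArg (fun ψ : deltaGraph n ≃g deltaGraph n => ψ 1) hgh
    simpa [hΨ] using this
  · have key : ∀ x, (Ψ (φ 1) * φ) x = x :=
      deltaGraph_iso_eq_id hn _ (by rw [RelIso.mul_apply, hΨ, mul_inv_cancel])
    have h1 : Ψ (φ 1) * φ = 1 := RelIso.ext key
    rw [map_inv]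
    exact inv_eq_of_mul_eq_one_right h1
end

section
/- For every integer n ≥ 3, the graph Σ_n = Cay(D_n × Z_3, {(τ_1, 0), (τ_0, 1), (τ_0, 2)}) has girth exactly 6. -/
/-- The graph `Σ_n = Cay(D_n × Z_3, {(τ_1, 0), (τ_0, 1), (τ_0, 2)})`,
where `Z_3` is the cyclic group of order 3 (written multiplicatively). -/
def sigmaGraph (n : ℕ) : SimpleGraph (DihedralGroup n × Multiplicative (ZMod 3)) :=
  cayley ({(dihTau 1, 1), (dihTau 0, Multiplicative.ofAdd 1), (dihTau 0, Multiplicative.ofAdd 2)} :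
    Set (DihedralGroup n × Multiplicative (ZMod 3)))

open DihedralGroup in
theorem sigmaGraph_adj_r_sr {n : ℕ} (i j : ZMod n) (p q : Multiplicative (ZMod 3)) :
    (sigmaGraph n).Adj (r i, p) (sr j, q) ↔ (j = i - 1 ∧ q = p) ∨ (j = i ∧ q ≠ p) := by
  have h : ∀ p q : Multiplicative (ZMod 3),
      (p * q⁻¹ = 1 ↔ q = p) ∧ (q * p⁻¹ = 1 ↔ q = p) ∧
      (p * q⁻¹ = Multiplicative.ofAdd 1 ∨ p * q⁻¹ = Multiplicative.ofAdd 2 ↔ q ≠ p) ∧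
      (q * p⁻¹ = Multiplicative.ofAdd 1 ∨ q * p⁻¹ = Multiplicative.ofAdd 2 ↔ q ≠ p) := by
    decide
  obtain ⟨h1, h2, h3, h4⟩ := h p q
  have e1 : j - i = -1 ↔ j = i - 1 := by grind
  simp only [sigmaGraph, cayley, dihTau, SimpleGraph.fromRel_adj, Set.mem_insert_iff,
    Set.mem_singleton_iff, Prod.mk_mul_mk, Prod.inv_mk, Prod.mk.injEq, inv_r, inv_sr, r_mul_sr,
    sr_mul_r, r_pow, sr.injEq, ne_eq, reduceCtorEq, false_and, not_false_eq_true, true_and,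
    Nat.cast_one, Nat.cast_zero, mul_one, mul_zero, zero_sub, sub_zero, ← sub_eq_add_neg,
    ← and_or_left, h1, h2, h3, h4, e1, sub_eq_zero, or_self]

open DihedralGroup in
theorem sigmaGraph_not_adj_r_r {n : ℕ} (i j : ZMod n) (p q : Multiplicative (ZMod 3)) :
    ¬ (sigmaGraph n).Adj (r i, p) (r j, q) := by
  simp [sigmaGraph, cayley, dihTau]

open DihedralGroup in
theorem sigmaGraph_not_adj_sr_sr {n : ℕ} (i j : ZMod n) (p q : Multiplicative (ZMod 3)) :
    ¬ (sigmaGraph n).Adj (sr i, p) (sr j, q) := by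
  simp [sigmaGraph, cayley, dihTau]

/-- The colouring of `Σ_n` that separates rotations from reflections. -/
def sigmaColoring (n : ℕ) : (sigmaGraph n).Coloring Bool :=
  SimpleGraph.Coloring.mk
    (fun x => match x.1 with
      | DihedralGroup.r _ => true
      | DihedralGroup.sr _ => false) (by
    rintro ⟨_ | _, _⟩ ⟨_ | _, _⟩ h
    · exact absurd h (sigmaGraph_not_adj_r_r _ _ _ _)
    · simp
    · simp
    · exact absurd h (sigmaGraph_not_adj_sr_sr _ _ _ _))

/-- Two distinct rotations have at most one common neighbour in `Σ_n`. -/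
theorem sigmaGraph_common_neighbor_unique_of_r {n : ℕ} (hn : 3 ≤ n) {i : ZMod n}
    {p : Multiplicative (ZMod 3)} {b c d : DihedralGroup n × Multiplicative (ZMod 3)}
    (hab : (sigmaGraph n).Adj (DihedralGroup.r i, p) b) (hbc : (sigmaGraph n).Adj b c)
    (hcd : (sigmaGraph n).Adj c d) (hda : (sigmaGraph n).Adj d (DihedralGroup.r i, p))
    (hac : (DihedralGroup.r i, p) ≠ c) : b = d := by
  have two_ne_zero : (2 : ZMod n) ≠ 0 := by
    intro h
    have := (ZMod.natCast_eq_zero_iff 2 n).1 (by exact_mod_cast h)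
    have := Nat.le_of_dvd (by norm_num) this
    omega
  have eq_of_ne : ∀ p q s t : Multiplicative (ZMod 3),
      p ≠ s → q ≠ p → q ≠ s → t ≠ p → t ≠ s → q = t := by decide
  obtain ⟨j | j, q⟩ := b
  · exact absurd hab (sigmaGraph_not_adj_r_r _ _ _ _)
  obtain ⟨k | k, s⟩ := c
  swap
  · exact absurd hbc (sigmaGraph_not_adj_sr_sr _ _ _ _)
  obtain ⟨l | l, t⟩ := d
  · exact absurd hcd (sigmaGraph_not_adj_r_r _ _ _ _)
  rw [SimpleGraph.adj_comm] at hbc hda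
  rw [sigmaGraph_adj_r_sr] at hab hbc hcd hda
  have := eq_of_ne p q s t
  simp only [ne_eq, Prod.mk.injEq, DihedralGroup.r.injEq, DihedralGroup.sr.injEq] at hac ⊢
  grind

/-- The graph `Σ_n` has no cycle of length four. -/
theorem sigmaGraph_eq_of_four_adj {n : ℕ} (hn : 3 ≤ n)
    {a b c d : DihedralGroup n × Multiplicative (ZMod 3)}
    (hab : (sigmaGraph n).Adj a b) (hbc : (sigmaGraph n).Adj b c)
    (hcd : (sigmaGraph n).Adj c d) (hda : (sigmaGraph n).Adj d a) : a = c ∨ b = d := by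
  by_contra! h
  obtain ⟨i | i, p⟩ := a
  · exact h.2 (sigmaGraph_common_neighbor_unique_of_r hn hab hbc hcd hda h.1)
  obtain ⟨j | j, q⟩ := b
  · exact h.1 (sigmaGraph_common_neighbor_unique_of_r hn hbc hcd hda hab h.2).symm
  · exact absurd hab (sigmaGraph_not_adj_sr_sr _ _ _ _)

theorem six_le_length_of_isCycle_sigmaGraph {n : ℕ} (hn : 3 ≤ n)
    {a : DihedralGroup n × Multiplicative (ZMod 3)} {w : (sigmaGraph n).Walk a a}
    (hw : w.IsCycle) : 6 ≤ w.length := by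
  have heven : Even w.length := ((sigmaColoring n).even_length_iff_congr w).2 Iff.rfl
  have hthree := hw.three_le_length
  have hfour : w.length ≠ 4 := by
    intro h
    match w, h with
    | .cons hab (.cons hbc (.cons hcd (.cons hda .nil))), _ =>
      have hnodup := hw.support_nodup
      simp only [SimpleGraph.Walk.support_cons, SimpleGraph.Walk.support_nil, List.tail_cons,
        List.nodup_cons, List.mem_cons] at hnodup
      have := sigmaGraph_eq_of_four_adj hn hab hbc hcd hda
      grind
  obtain ⟨m, hm⟩ := heven
  omega

open DihedralGroup in
theorem exists_isCycle_sigmaGraph_length_eq_six (n : ℕ) :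
    ∃ (a : _) (w : (sigmaGraph n).Walk a a), w.IsCycle ∧ w.length = 6 := by
  let z (k : ZMod 3) : Multiplicative (ZMod 3) := Multiplicative.ofAdd k
  have h (p q : ZMod 3) (hpq : q ≠ p) : (sigmaGraph n).Adj (r 0, z p) (sr 0, z q) :=
    (sigmaGraph_adj_r_sr _ _ _ _).2 (.inr ⟨rfl, hpq⟩)
  refine ⟨(r 0, z 0),
    .cons (h 0 1 (by decide)) (.cons (h 2 1 (by decide)).symm (.cons (h 2 0 (by decide))
      (.cons (h 1 0 (by decide)).symm (.cons (h 1 2 (by decide))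
        (.cons (h 0 2 (by decide)).symm .nil))))), ?_, rfl⟩
  have h01 : z 0 ≠ z 1 := by decide
  have h02 : z 0 ≠ z 2 := by decide
  have h12 : z 1 ≠ z 2 := by decide
  simp [SimpleGraph.Walk.cons_isCycle_iff, SimpleGraph.Walk.cons_isPath_iff, -r_zero, h01, h02,
    h12, h01.symm, h02.symm, h12.symm]

theorem sigma_girth_eq_six (n : ℕ) (hn : 3 ≤ n) : (sigmaGraph n).girth = 6 := by
  obtain ⟨a, w, hw, hlen⟩ := exists_isCycle_sigmaGraph_length_eq_six n
  refine le_antisymm (hlen ▸ SimpleGraph.girth_le_length hw) ?_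
  obtain ⟨b, v, hv, hgirth⟩ := SimpleGraph.exists_girth_eq_length.2 fun hG => hG w hw
  exact hgirth ▸ six_le_length_of_isCycle_sigmaGraph hn hv
end

section
/- For every integer n ≥ 4, the graph Σ_n = Cay(D_n × Z_3, {(τ_1, 0), (τ_0, 1), (τ_0, 2)}) is girth-regular with signature (2, 3, 3); that is, every vertex of Σ_n is incident to exactly one edge lying on exactly 2 six-cycles and two edges lying on exactly 3 six-cycles each. -/
/-- The number of cycles of length 6 in `G` (identified with their edge sets)
that contain the edge `e`. -/
noncomputable def sixCycleCount {V : Type*} (G : SimpleGraph V) (e : Sym2 V) : ℕ :=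
  Set.ncard {s : Set (Sym2 V) |
    (∃ (v : V) (w : G.Walk v v), w.IsCycle ∧ w.length = 6 ∧ s = {e' | e' ∈ w.edges}) ∧ e ∈ s}

open SimpleGraph

theorem mem_sixCycles_iff {V : Type*} (G : SimpleGraph V) (u v : V) (s : Set (Sym2 V)) :
    ((∃ (x : V) (w : G.Walk x x), w.IsCycle ∧ w.length = 6 ∧ s = {e' | e' ∈ w.edges}) ∧
      s(u, v) ∈ s) ↔
    ∃ c d e f : V, [u, v, c, d, e, f].Nodup ∧ G.Adj u v ∧ G.Adj v c ∧ G.Adj c d ∧ G.Adj d e ∧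
      G.Adj e f ∧ G.Adj f u ∧
      s = {s(u, v), s(v, c), s(c, d), s(d, e), s(e, f), s(f, u)} := by
  constructor
  · rintro ⟨⟨x, w, hc, hl, rfl⟩, he⟩
    have hn := hc.support_nodup
    clear hc
    rcases w with _ | ⟨h0, _ | ⟨h1, _ | ⟨h2, _ | ⟨h3, _ | ⟨h4, _ | ⟨h5, _ | ⟨h6, w⟩⟩⟩⟩⟩⟩⟩ <;>
      simp only [Walk.length_cons, Walk.length_nil] at hl <;> try omega
    rename_i b c d e f
    simp only [Walk.support_cons, Walk.support_nil, List.tail_cons] at hn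
    simp only [Walk.edges_cons, Walk.edges_nil, Set.mem_ofPred_eq, List.mem_cons, List.not_mem_nil,
      or_false, Sym2.eq_iff] at he
    simp only [Walk.edges_cons, Walk.edges_nil, List.mem_cons, List.not_mem_nil, or_false]
    rcases he with (⟨hu, hv⟩ | ⟨hu, hv⟩) | (⟨hu, hv⟩ | ⟨hu, hv⟩) | (⟨hu, hv⟩ | ⟨hu, hv⟩) |
      (⟨hu, hv⟩ | ⟨hu, hv⟩) | (⟨hu, hv⟩ | ⟨hu, hv⟩) | (⟨hu, hv⟩ | ⟨hu, hv⟩) <;> subst u v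
    · exact ⟨c, d, e, f, by grind, h0, h1, h2, h3, h4, h5, by ext t; simp⟩
    · exact ⟨f, e, d, c, by grind, h0.symm, h5.symm, h4.symm, h3.symm, h2.symm, h1.symm,
        by ext t; simp only [Sym2.eq_swap]; simp; tauto⟩
    · exact ⟨d, e, f, x, by grind, h1, h2, h3, h4, h5, h0, by ext t; simp; tauto⟩
    · exact ⟨x, f, e, d, by grind, h1.symm, h0.symm, h5.symm, h4.symm, h3.symm, h2.symm,
        by ext t; simp only [Sym2.eq_swap]; simp; tauto⟩
    · exact ⟨e, f, x, b, by grind, h2, h3, h4, h5, h0, h1, by ext t; simp; tauto⟩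
    · exact ⟨b, x, f, e, by grind, h2.symm, h1.symm, h0.symm, h5.symm, h4.symm, h3.symm,
        by ext t; simp only [Sym2.eq_swap]; simp; tauto⟩
    · exact ⟨f, x, b, c, by grind, h3, h4, h5, h0, h1, h2, by ext t; simp; tauto⟩
    · exact ⟨c, b, x, f, by grind, h3.symm, h2.symm, h1.symm, h0.symm, h5.symm, h4.symm,
        by ext t; simp only [Sym2.eq_swap]; simp; tauto⟩
    · exact ⟨x, b, c, d, by grind, h4, h5, h0, h1, h2, h3, by ext t; simp; tauto⟩
    · exact ⟨d, c, b, x, by grind, h4.symm, h3.symm, h2.symm, h1.symm, h0.symm, h5.symm,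
        by ext t; simp only [Sym2.eq_swap]; simp; tauto⟩
    · exact ⟨b, c, d, e, by grind, h5, h0, h1, h2, h3, h4, by ext t; simp; tauto⟩
    · exact ⟨e, d, c, b, by grind, h5.symm, h4.symm, h3.symm, h2.symm, h1.symm, h0.symm,
        by ext t; simp only [Sym2.eq_swap]; simp; tauto⟩
  · rintro ⟨c, d, e, f, hn, h0, h1, h2, h3, h4, h5, rfl⟩
    refine ⟨⟨u, .cons h0 (.cons h1 (.cons h2 (.cons h3 (.cons h4 (.cons h5 .nil))))), ?_, rfl, ?_⟩,
      by simp⟩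
    · rw [Walk.cons_isCycle_iff, Walk.isPath_def]
      simp only [Walk.support_cons, Walk.support_nil, Walk.edges_cons, Walk.edges_nil,
        List.mem_cons, List.not_mem_nil, or_false, Sym2.eq_iff]
      grind
    · ext t
      simp

/-- Reduction modulo `n` of the infinite dihedral group. -/
def dihedralCast (n : ℕ) : DihedralGroup 0 →* DihedralGroup n where
  toFun
    | .r k => .r (Int.cast (show ℤ from k))
    | .sr k => .sr (Int.cast (show ℤ from k))
  map_one' := congrArg DihedralGroup.r Int.cast_zero
  map_mul' := by
    rintro (i | i) (j | j)
    · exact congrArg DihedralGroup.r (Int.cast_add _ _)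
    · exact congrArg DihedralGroup.sr (Int.cast_sub _ _)
    · exact congrArg DihedralGroup.sr (Int.cast_add _ _)
    · exact congrArg DihedralGroup.r (Int.cast_sub _ _)

/-- The generators of `D_n × Z_3` that define `Σ_n`. -/
def sigmaGen (n : ℕ) : Fin 3 → DihedralGroup n × Multiplicative (ZMod 3) :=
  ![(dihTau 1, 1), (dihTau 0, Multiplicative.ofAdd 1), (dihTau 0, Multiplicative.ofAdd 2)]

/-- The covering map `Σ_0 → Σ_n` sending the identity to `u`. -/
def sigmaCover {n : ℕ} (u : DihedralGroup n × Multiplicative (ZMod 3))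
    (x : DihedralGroup 0 × Multiplicative (ZMod 3)) : DihedralGroup n × Multiplicative (ZMod 3) :=
  (dihedralCast n x.1, x.2) * u

/-- The rotations `ρ^k` with `|k| < 4`, together with all reflections. -/
def IsShort : DihedralGroup 0 → Prop
  | .r k => Int.natAbs k < 4
  | .sr _ => True

instance : DecidablePred IsShort
  | .r k => inferInstanceAs (Decidable (Int.natAbs k < 4))
  | .sr _ => inferInstanceAs (Decidable True)

/-- The elements `ρ^k` and `τρ^k` with `-1 ≤ k ≤ 2`. -/
def InWindow : DihedralGroup 0 → Prop
  | .r k => -1 ≤ (show ℤ from k) ∧ (show ℤ from k) ≤ 2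
  | .sr k => -1 ≤ (show ℤ from k) ∧ (show ℤ from k) ≤ 2

instance : DecidablePred InWindow
  | .r k => inferInstanceAs (Decidable (-1 ≤ (show ℤ from k) ∧ (show ℤ from k) ≤ 2))
  | .sr k => inferInstanceAs (Decidable (-1 ≤ (show ℤ from k) ∧ (show ℤ from k) ≤ 2))

theorem InWindow.isShort_mul_inv {x y : DihedralGroup 0} (hx : InWindow x) (hy : InWindow y) :
    IsShort (x * y⁻¹) := by
  rcases x with i | i <;> rcases y with j | j
  · change Int.natAbs ((i : ℤ) + -(j : ℤ)) < 4
    simp only [InWindow] at hx hy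
    omega
  · trivial
  · trivial
  · change Int.natAbs ((j : ℤ) - (i : ℤ)) < 4
    simp only [InWindow] at hx hy
    omega

theorem eq_one_of_dihedralCast_eq_one {n : ℕ} (hn : 4 ≤ n) {x : DihedralGroup 0} (hx : IsShort x)
    (h : dihedralCast n x = 1) : x = 1 := by
  rcases x with k | k
  · have h' : ((show ℤ from k : ℤ) : ZMod n) = 0 := DihedralGroup.r.inj h
    rw [ZMod.intCast_zmod_eq_zero_iff_dvd] at h'
    have hk : Int.natAbs k < 4 := hx
    have : (show ℤ from k) = 0 := Int.eq_zero_of_abs_lt_dvd h' (by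
      rw [Int.abs_eq_natAbs]
      change ((Int.natAbs k : ℕ) : ℤ) < n
      omega)
    exact congrArg DihedralGroup.r this
  · exact DihedralGroup.noConfusion rfl (heq_of_eq h)

theorem sigmaCover_eq_imp {n : ℕ} (hn : 4 ≤ n) (u : DihedralGroup n × Multiplicative (ZMod 3))
    {x y : DihedralGroup 0 × Multiplicative (ZMod 3)} (hxy : IsShort (x.1 * y.1⁻¹))
    (h : sigmaCover u x = sigmaCover u y) : x = y := by
  have h' := Prod.ext_iff.1 (mul_right_cancel h)
  refine Prod.ext ?_ h'.2
  rw [← mul_inv_eq_one]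
  apply eq_one_of_dihedralCast_eq_one hn hxy
  rw [map_mul, map_inv, mul_inv_eq_one]
  exact h'.1

theorem sigmaCover_one {n : ℕ} (u : DihedralGroup n × Multiplicative (ZMod 3)) :
    sigmaCover u 1 = u := by
  simp only [sigmaCover, Prod.fst_one, map_one, Prod.snd_one]
  exact one_mul u

theorem sigmaCover_sigmaGen_mul {n : ℕ} (u : DihedralGroup n × Multiplicative (ZMod 3))
    (i : Fin 3) (x : DihedralGroup 0 × Multiplicative (ZMod 3)) :
    sigmaCover u (sigmaGen 0 i * x) = sigmaGen n i * sigmaCover u x := by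
  have h : (dihedralCast n (sigmaGen 0 i).1, (sigmaGen 0 i).2) = sigmaGen n i := by
    have h0 : dihedralCast n (dihTau 0) = dihTau 0 := by
      simp only [dihTau, pow_zero, one_mul]
      exact congrArg DihedralGroup.sr Int.cast_zero
    have h1 : dihedralCast n (dihTau 1) = dihTau 1 := by
      simp only [dihTau, pow_one, DihedralGroup.r_mul_sr, zero_sub]
      exact congrArg DihedralGroup.sr (by simp : ((-1 : ℤ) : ZMod n) = -1)
    fin_cases i <;> simp [sigmaGen, h0, h1]
  rw [← h]
  simp [sigmaCover, mul_assoc, Prod.ext_iff]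

theorem sigmaGen_ne_one (n : ℕ) (i : Fin 3) : sigmaGen n i ≠ 1 := by
  fin_cases i <;> simp [sigmaGen, dihTau, DihedralGroup.one_def, -DihedralGroup.r_zero]

theorem exists_sigmaGen_inv (n : ℕ) (i : Fin 3) : ∃ j, (sigmaGen n i)⁻¹ = sigmaGen n j := by
  have h : (Multiplicative.ofAdd (1 : ZMod 3))⁻¹ = Multiplicative.ofAdd 2 := by decide
  have h' : (Multiplicative.ofAdd (2 : ZMod 3))⁻¹ = Multiplicative.ofAdd 1 := by decide
  fin_cases i
  · exact ⟨0, by simp [sigmaGen, dihTau]⟩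
  · exact ⟨2, by simp [sigmaGen, dihTau, h]⟩
  · exact ⟨1, by simp [sigmaGen, dihTau, h']⟩

theorem sigmaGraph_adj_iff {n : ℕ} {x y : DihedralGroup n × Multiplicative (ZMod 3)} :
    (sigmaGraph n).Adj x y ↔ ∃ i, y = sigmaGen n i * x := by
  have hS : ∀ z, z ∈ ({(dihTau 1, 1), (dihTau 0, Multiplicative.ofAdd 1),
      (dihTau 0, Multiplicative.ofAdd 2)} : Set (DihedralGroup n × Multiplicative (ZMod 3))) ↔
      ∃ i, z = sigmaGen n i := by
    intro z
    simp [sigmaGen, Fin.exists_fin_succ]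
  simp only [sigmaGraph, cayley, fromRel_adj, hS, mul_inv_eq_iff_eq_mul]
  constructor
  · rintro ⟨-, ⟨i, rfl⟩ | h⟩
    · obtain ⟨j, hj⟩ := exists_sigmaGen_inv n i
      exact ⟨j, by rw [← hj, inv_mul_cancel_left]⟩
    · exact h
  · rintro ⟨i, rfl⟩
    refine ⟨fun h => sigmaGen_ne_one n i ?_, Or.inr ⟨i, rfl⟩⟩
    rwa [eq_comm, mul_eq_right] at h

theorem sigmaGraph_adj_sigmaCover_iff {n : ℕ} {u y : DihedralGroup n × Multiplicative (ZMod 3)}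
    {x : DihedralGroup 0 × Multiplicative (ZMod 3)} :
    (sigmaGraph n).Adj (sigmaCover u x) y ↔ ∃ i, y = sigmaCover u (sigmaGen 0 i * x) := by
  simp only [sigmaGraph_adj_iff, sigmaCover_sigmaGen_mul]

/-- The vertices after the first one of the walk in `Σ_0` that starts at the identity and follows
the generators `s, a, b, c, d`. -/
def walkVertex (s : Fin 3) (t : Fin 3 × Fin 3 × Fin 3 × Fin 3) :
    Fin 5 → DihedralGroup 0 × Multiplicative (ZMod 3) :=
  ![sigmaGen 0 s,
    sigmaGen 0 t.1 * sigmaGen 0 s,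
    sigmaGen 0 t.2.1 * (sigmaGen 0 t.1 * sigmaGen 0 s),
    sigmaGen 0 t.2.2.1 * (sigmaGen 0 t.2.1 * (sigmaGen 0 t.1 * sigmaGen 0 s)),
    sigmaGen 0 t.2.2.2 * (sigmaGen 0 t.2.2.1 * (sigmaGen 0 t.2.1 *
      (sigmaGen 0 t.1 * sigmaGen 0 s)))]

def walkSupport (s : Fin 3) (t : Fin 3 × Fin 3 × Fin 3 × Fin 3) :
    List (DihedralGroup 0 × Multiplicative (ZMod 3)) :=
  [1, walkVertex s t 0, walkVertex s t 1, walkVertex s t 2, walkVertex s t 3, walkVertex s t 4]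

/-- The edges of the closed hexagon through the vertices of `walkSupport s t`. -/
def hexagonEdges (s : Fin 3) (t : Fin 3 × Fin 3 × Fin 3 × Fin 3) :
    Finset (Sym2 (DihedralGroup 0 × Multiplicative (ZMod 3))) :=
  {s(1, walkVertex s t 0), s(walkVertex s t 0, walkVertex s t 1),
    s(walkVertex s t 1, walkVertex s t 2), s(walkVertex s t 2, walkVertex s t 3),
    s(walkVertex s t 3, walkVertex s t 4), s(walkVertex s t 4, 1)}

/-- The continuations of the edge from the identity to the generator `s` to a hexagon of `Σ_0`. -/
def hexagonWords (s : Fin 3) : Finset (Fin 3 × Fin 3 × Fin 3 × Fin 3) :=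
  {t | (walkSupport s t).Nodup ∧ ∃ i, sigmaGen 0 i * walkVertex s t 4 = 1}

theorem card_hexagonWords :
    (hexagonWords 0).card = 2 ∧ (hexagonWords 1).card = 3 ∧ (hexagonWords 2).card = 3 := by
  decide +kernel

theorem isShort_walk (s : Fin 3) (t : Fin 3 × Fin 3 × Fin 3 × Fin 3) (i : Fin 3) :
    IsShort (sigmaGen 0 i * walkVertex s t 4).1 := by
  revert s t i
  decide +kernel

theorem inWindow_of_mem_walkSupport (s : Fin 3) : ∀ t ∈ hexagonWords s, ∀ x ∈ walkSupport s t,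
    InWindow x.1 := by
  revert s
  decide +kernel

theorem hexagonEdges_injOn (s : Fin 3) : ∀ t ∈ hexagonWords s, ∀ t' ∈ hexagonWords s,
    hexagonEdges s t = hexagonEdges s t' → t = t' := by
  revert s
  decide +kernel

theorem mem_walkSupport_of_mem_hexagonEdges {s : Fin 3} {t : Fin 3 × Fin 3 × Fin 3 × Fin 3}
    {e : Sym2 (DihedralGroup 0 × Multiplicative (ZMod 3))} (he : e ∈ hexagonEdges s t)
    {x : DihedralGroup 0 × Multiplicative (ZMod 3)} (hx : x ∈ e) : x ∈ walkSupport s t := by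
  simp only [hexagonEdges, Finset.mem_insert, Finset.mem_singleton] at he
  simp only [walkSupport, List.mem_cons, List.not_mem_nil, or_false]
  rcases he with rfl | rfl | rfl | rfl | rfl | rfl <;> rw [Sym2.mem_iff] at hx <;> tauto

theorem sym2_map_injOn {α β : Type*} {f : α → β} {s : Set α} (hf : Set.InjOn f s) :
    Set.InjOn (Sym2.map f) {e | ∀ x ∈ e, x ∈ s} := by
  intro p hp q hq h
  induction p with | _ a b
  induction q with | _ c d
  simp only [Set.mem_ofPred_eq, Sym2.mem_iff, forall_eq_or_imp, forall_eq] at hp hq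
  simp only [Sym2.map_mk, Sym2.eq_iff] at h ⊢
  exact h.imp (fun h => ⟨hf hp.1 hq.1 h.1, hf hp.2 hq.2 h.2⟩)
    (fun h => ⟨hf hp.1 hq.2 h.1, hf hp.2 hq.1 h.2⟩)

theorem sigmaCover_injOn {n : ℕ} (hn : 4 ≤ n) (u : DihedralGroup n × Multiplicative (ZMod 3)) :
    Set.InjOn (sigmaCover u) {x | InWindow x.1} :=
  fun _ hx _ hy h => sigmaCover_eq_imp hn u (hx.isShort_mul_inv hy) h

theorem sixCycleCount_sigmaGraph {n : ℕ} (hn : 4 ≤ n)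
    (u : DihedralGroup n × Multiplicative (ZMod 3)) (s : Fin 3) :
    sixCycleCount (sigmaGraph n) s(u, sigmaGen n s * u) = (hexagonWords s).card := by
  have hs : sigmaGen n s * u = sigmaCover u (sigmaGen 0 s) := by
    rw [← mul_one (sigmaGen 0 s), sigmaCover_sigmaGen_mul, sigmaCover_one]
  have key : {S : Set (Sym2 (DihedralGroup n × Multiplicative (ZMod 3))) |
      (∃ v, ∃ w : (sigmaGraph n).Walk v v, w.IsCycle ∧ w.length = 6 ∧ S = {e' | e' ∈ w.edges}) ∧
      s(u, sigmaGen n s * u) ∈ S} =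
      (fun t => Sym2.map (sigmaCover u) '' (hexagonEdges s t : Set _)) ''
        (hexagonWords s : Set _) := by
    ext S
    rw [Set.mem_ofPred_eq, mem_sixCycles_iff, hs]
    constructor
    · rintro ⟨x2, x3, x4, x5, hd, -, h2, h3, h4, h5, h6, rfl⟩
      obtain ⟨a, rfl⟩ := sigmaGraph_adj_sigmaCover_iff.1 h2
      obtain ⟨b, rfl⟩ := sigmaGraph_adj_sigmaCover_iff.1 h3
      obtain ⟨c, rfl⟩ := sigmaGraph_adj_sigmaCover_iff.1 h4
      obtain ⟨d, rfl⟩ := sigmaGraph_adj_sigmaCover_iff.1 h5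
      obtain ⟨i, hi⟩ := sigmaGraph_adj_sigmaCover_iff.1 h6
      refine ⟨(a, b, c, d), ?_, ?_⟩
      · simp only [hexagonWords, Finset.coe_filter, Finset.mem_univ, true_and, Set.mem_ofPred_eq]
        refine ⟨List.Nodup.of_map (sigmaCover u) ?_, i, ?_⟩
        · simpa [walkSupport, walkVertex, sigmaCover_one] using hd
        · refine sigmaCover_eq_imp hn u ?_ ((sigmaCover_one u).trans hi).symm
          rw [Prod.fst_one, inv_one, mul_one]
          exact isShort_walk s (a, b, c, d) i
      · simp [hexagonEdges, Set.image_insert_eq, walkVertex, sigmaCover_one]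
    · rintro ⟨t, ht, rfl⟩
      have hw := inWindow_of_mem_walkSupport s t ht
      simp only [hexagonWords, Finset.coe_filter, Finset.mem_univ, true_and,
        Set.mem_ofPred_eq] at ht
      obtain ⟨hd, i, hi⟩ := ht
      have hd' := hd.map_on fun x hx y hy => sigmaCover_injOn hn u (hw x hx) (hw y hy)
      refine ⟨sigmaCover u (walkVertex s t 1), sigmaCover u (walkVertex s t 2),
        sigmaCover u (walkVertex s t 3), sigmaCover u (walkVertex s t 4), ?_, ?_,
        sigmaGraph_adj_sigmaCover_iff.2 ⟨_, rfl⟩, sigmaGraph_adj_sigmaCover_iff.2 ⟨_, rfl⟩,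
        sigmaGraph_adj_sigmaCover_iff.2 ⟨_, rfl⟩, sigmaGraph_adj_sigmaCover_iff.2 ⟨_, rfl⟩,
        sigmaGraph_adj_sigmaCover_iff.2 ⟨i, by rw [hi, sigmaCover_one]⟩, ?_⟩
      · simp only [walkSupport, List.map_cons, List.map_nil, sigmaCover_one] at hd'
        exact hd'
      · exact sigmaGraph_adj_iff.2 ⟨s, hs.symm⟩
      · simp [hexagonEdges, Set.image_insert_eq, sigmaCover_one, walkVertex]
  rw [sixCycleCount, key, Set.InjOn.ncard_image, Set.ncard_coe_finset]
  intro t ht t' ht' h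
  have hsub : ∀ t ∈ hexagonWords s, (hexagonEdges s t : Set _) ⊆
      {e | ∀ x ∈ e, x ∈ {x : DihedralGroup 0 × Multiplicative (ZMod 3) | InWindow x.1}} :=
    fun t ht e he x hx =>
      inWindow_of_mem_walkSupport s t ht x (mem_walkSupport_of_mem_hexagonEdges he hx)
  exact hexagonEdges_injOn s t ht t' ht' <| Finset.coe_injective <|
    ((sym2_map_injOn (sigmaCover_injOn hn u)).image_eq_image_iff (hsub t ht) (hsub t' ht')).1 h

theorem sigma_signature_two_three_three (n : ℕ) (hn : 4 ≤ n) :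
    ∀ v : DihedralGroup n × Multiplicative (ZMod 3),
      Set.ncard {e ∈ (sigmaGraph n).incidenceSet v | sixCycleCount (sigmaGraph n) e = 2} = 1 ∧
      Set.ncard {e ∈ (sigmaGraph n).incidenceSet v | sixCycleCount (sigmaGraph n) e = 3} = 2 := by
  intro v
  obtain ⟨c0, c1, c2⟩ := card_hexagonWords
  have h0 := (sixCycleCount_sigmaGraph hn v 0).trans c0
  have h1 := (sixCycleCount_sigmaGraph hn v 1).trans c1
  have h2 := (sixCycleCount_sigmaGraph hn v 2).trans c2
  have hI : (sigmaGraph n).incidenceSet v =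
      {s(v, sigmaGen n 0 * v), s(v, sigmaGen n 1 * v), s(v, sigmaGen n 2 * v)} := by
    ext e
    induction e with | _ x y
    simp only [mk'_mem_incidenceSet_iff, Set.mem_insert_iff, Set.mem_singleton_iff]
    constructor
    · rintro ⟨h, rfl | rfl⟩
      · obtain ⟨i, rfl⟩ := sigmaGraph_adj_iff.1 h
        fin_cases i <;> simp
      · obtain ⟨i, rfl⟩ := sigmaGraph_adj_iff.1 h.symm
        rw [Sym2.eq_swap]
        fin_cases i <;> simp
    · have hadj : ∀ i, (sigmaGraph n).Adj v (sigmaGen n i * v) :=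
        fun i => sigmaGraph_adj_iff.2 ⟨i, rfl⟩
      simp only [Sym2.eq_iff]
      rintro ((⟨rfl, rfl⟩ | ⟨rfl, rfl⟩) | (⟨rfl, rfl⟩ | ⟨rfl, rfl⟩) | (⟨rfl, rfl⟩ | ⟨rfl, rfl⟩)) <;>
        simp [hadj, (hadj _).symm]
  constructor
  · rw [Set.ncard_eq_one]
    refine ⟨s(v, sigmaGen n 0 * v), ?_⟩
    ext e
    simp only [hI, Set.mem_ofPred_eq, Set.mem_insert_iff, Set.mem_singleton_iff]
    constructor
    · rintro ⟨rfl | rfl | rfl, h⟩ <;> first | rfl | omega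
    · rintro rfl
      exact ⟨Or.inl rfl, h0⟩
  · rw [Set.ncard_eq_two]
    refine ⟨s(v, sigmaGen n 1 * v), s(v, sigmaGen n 2 * v), ?_, ?_⟩
    · rw [Ne, Sym2.congr_right, mul_left_inj]
      have h12 : Multiplicative.ofAdd (1 : ZMod 3) ≠ Multiplicative.ofAdd 2 := by decide
      exact fun h => h12 (congrArg Prod.snd h)
    · ext e
      simp only [hI, Set.mem_ofPred_eq, Set.mem_insert_iff, Set.mem_singleton_iff]
      constructor
      · rintro ⟨rfl | h, h'⟩
        · omega
        · exact h
      · rintro (rfl | rfl)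
        · exact ⟨Or.inr (Or.inl rfl), h1⟩
        · exact ⟨Or.inr (Or.inr rfl), h2⟩
end

section
/- Let Γ be a finite simple cubic graph of girth 6 and let G be a group of automorphisms of Γ acting transitively on its vertices. Then for every vertex u₀ of Γ there exists a neighbour u of u₀ and an automorphism φ ∈ G such that φ(u₀) = u and φ(u) = u₀. -/
open Finset in
/-- If a group of automorphisms of a finite graph is transitive on vertices and the valency
is odd, then some neighbour of each vertex can be swapped with that vertex. -/
theorem exists_neighbour_swap_of_odd {V : Type*} [Fintype V] (Γ : SimpleGraph V)
    (G : Subgroup (Γ ≃g Γ)) (htrans : ∀ u v : V, ∃ φ ∈ G, φ u = v)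
    (u₀ : V) (hodd : Odd (Γ.neighborSet u₀).ncard) :
    ∃ u : V, Γ.Adj u₀ u ∧ ∃ φ ∈ G, φ u₀ = u ∧ φ u = u₀ := by
  classical
  by_contra hno
  let S : Setoid (V × V) :=
    { r := fun p q => ∃ φ ∈ G, φ p.1 = q.1 ∧ φ p.2 = q.2
      iseqv :=
        { refl := fun p => ⟨1, G.one_mem, rfl, rfl⟩
          symm := by
            rintro p q ⟨φ, hφ, h₁, h₂⟩
            refine ⟨φ⁻¹, G.inv_mem hφ, ?_, ?_⟩
            · rw [← h₁]; exact φ.symm_apply_apply _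
            · rw [← h₂]; exact φ.symm_apply_apply _
          trans := by
            rintro p q r ⟨φ, hφ, h₁, h₂⟩ ⟨ψ, hψ, h₃, h₄⟩
            refine ⟨ψ * φ, G.mul_mem hψ hφ, ?_, ?_⟩
            · rw [← h₃, ← h₁]; rfl
            · rw [← h₄, ← h₂]; rfl } }
  let mk : V → V → Quotient S := fun v w => Quotient.mk S (v, w)
  have mk_eq {a b c d : V} : mk a b = mk c d ↔ ∃ φ ∈ G, φ a = c ∧ φ b = d := Quotient.eq
  let σ : Quotient S → Quotient S := Quotient.map Prod.swap (by
    rintro p q ⟨φ, hφ, h₁, h₂⟩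
    exact ⟨φ, hφ, h₂, h₁⟩)
  have σ_mk (v w : V) : σ (mk v w) = mk w v := rfl
  have σσ (Q : Quotient S) : σ (σ Q) = Q := by
    induction Q using Quotient.inductionOn
    rfl
  let n : Quotient S → V → ℕ := fun Q v => #{w | Γ.Adj v w ∧ mk v w = Q}
  have n_const (Q : Quotient S) (v : V) : n Q v = n Q u₀ := by
    obtain ⟨φ, hφ, rfl⟩ := htrans u₀ v
    symm
    have key (w : V) : mk (φ u₀) (φ w) = mk u₀ w :=
      (mk_eq.2 ⟨φ, hφ, rfl, rfl⟩).symm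
    refine card_bij (fun w _ => φ w) ?_ (fun _ _ _ _ h => φ.injective h) ?_
    · intro w hw
      simpa [key, φ.map_adj_iff] using hw
    · intro w hw
      obtain ⟨x, rfl⟩ := φ.surjective w
      exact ⟨x, by simpa [key, φ.map_adj_iff] using hw, rfl⟩
  have n_swap (Q : Quotient S) : n (σ Q) u₀ = n Q u₀ := by
    have h := sum_card_bipartiteAbove_eq_sum_card_bipartiteBelow
      (s := (univ : Finset V)) (t := (univ : Finset V)) (fun v w => Γ.Adj v w ∧ mk v w = Q)
    have above (v : V) :
        #(bipartiteAbove (fun v w => Γ.Adj v w ∧ mk v w = Q) univ v) = n Q u₀ := n_const Q v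
    have below (w : V) :
        #(bipartiteBelow (fun v w => Γ.Adj v w ∧ mk v w = Q) univ w) = n (σ Q) u₀ := by
      rw [← n_const (σ Q) w]
      refine congrArg card (filter_congr fun v _ => ?_)
      rw [Γ.adj_comm, ← σ_mk v w, (Function.LeftInverse.injective σσ).eq_iff]
    simp only [above, below, sum_const, smul_eq_mul] at h
    exact (Nat.eq_of_mul_eq_mul_left (card_pos.2 ⟨u₀, mem_univ _⟩) h).symm
  have total : (Γ.neighborSet u₀).ncard = ∑ Q : Quotient S, n Q u₀ := by
    rw [Set.ncard_eq_toFinset_card', card_eq_sum_card_fiberwise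
      (f := fun w => mk u₀ w) (t := univ) (by simp)]
    refine sum_congr rfl fun Q _ => congrArg card ?_
    ext w
    simp
  have even : ∑ Q : Quotient S, (n Q u₀ : ZMod 2) = 0 := by
    refine sum_involution (fun Q _ => σ Q) ?_ ?_ (fun _ _ => mem_univ _) (fun Q _ => σσ Q)
    · intro Q _
      rw [n_swap]
      exact CharTwo.add_self_eq_zero _
    · intro Q _ hQ hfix
      have hpos : n Q u₀ ≠ 0 := fun h => hQ (by simp [h])
      obtain ⟨u, hu⟩ := card_ne_zero.1 hpos
      obtain ⟨hadj, rfl⟩ := (mem_filter.1 hu).2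
      obtain ⟨φ, hφ, h₁, h₂⟩ := mk_eq.1 hfix.symm
      exact hno ⟨u, hadj, φ, hφ, h₁, h₂⟩
  rw [← Nat.cast_sum, ← total, ZMod.natCast_eq_zero_iff_even] at even
  exact Nat.not_even_iff_odd.2 hodd even

theorem exists_neighbour_swap {V : Type*} [Fintype V] (Γ : SimpleGraph V)
    (hcubic : ∀ v : V, (Γ.neighborSet v).ncard = 3)
    (hgirth : Γ.girth = 6)
    (G : Subgroup (Γ ≃g Γ))
    (htrans : ∀ u v : V, ∃ φ ∈ G, φ u = v)
    (u₀ : V) :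
    ∃ u : V, Γ.Adj u₀ u ∧ ∃ φ ∈ G, φ u₀ = u ∧ φ u = u₀ :=
  exists_neighbour_swap_of_odd Γ G htrans u₀ (by rw [hcubic]; decide)
end
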